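/- Let p ≥ 1 be an integer, λ ∈ (0, 1/2], L ≥ 0 and Δ ∈ (0,1]. Let (Ω, ℱ, P) be a probability space, 𝒢 ⊆ ℱ a sub-σ-algebra, and W an ℝ^d-valued random vector with law N(0, Δ·I_d) that is independent of 𝒢. Let x : Ω → ℝⁿ, F : Ω → ℝⁿ, G : Ω → ℝ^{n×d} and M : Ω → [0,∞) be 𝒢-measurable with |F|² ≤ L² Δ^{−2λ} (1 + M) and |G|² ≤ L Δ^{−λ} (1 + M) almost surely, and assume E[|x|^{2p}] < ∞ and E[M^p] < ∞. Then there is a constant C > 0 depending only on p, n, d and L (and not on Δ, λ or the random variables) such that, almost surely, E[ |x + FΔ + GW|^{2p} | 𝒢 ] ≤ |x|^{2p} + p |x|^{2(p−1)} ( 2⟨x, F⟩ + (2p−1)|G|² ) Δ + C Δ (1 + |x|^{2p} + M^p). -/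

import Mathlib

open MeasureTheory Filter Set

noncomputable section

/-- Euclidean norm on `Fin n → ℝ`. -/
def vnorm {n : ℕ} (x : Fin n → ℝ) : ℝ := Real.sqrt (∑ i, x i ^ 2)

/-- Euclidean inner product on `Fin n → ℝ`. -/
def vdot {n : ℕ} (x y : Fin n → ℝ) : ℝ := ∑ i, x i * y i

/-- Frobenius norm of an `n × d` real matrix. -/
def frob {n d : ℕ} (A : Fin n → Fin d → ℝ) : ℝ := Real.sqrt (∑ i, ∑ j, A i j ^ 2)

/-- Matrix-vector multiplication. -/
def mulv {n d : ℕ} (A : Fin n → Fin d → ℝ) (w : Fin d → ℝ) : Fin n → ℝ :=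
  fun i => ∑ j, A i j * w j

lemma vnorm_nonneg {n : ℕ} (x : Fin n → ℝ) : 0 ≤ vnorm x := Real.sqrt_nonneg _

lemma vnorm_sq {n : ℕ} (x : Fin n → ℝ) : vnorm x ^ 2 = ∑ i, x i ^ 2 :=
  Real.sq_sqrt (Finset.sum_nonneg fun _ _ => sq_nonneg _)

lemma frob_nonneg {n d : ℕ} (A : Fin n → Fin d → ℝ) : 0 ≤ frob A := Real.sqrt_nonneg _

lemma frob_sq {n d : ℕ} (A : Fin n → Fin d → ℝ) : frob A ^ 2 = ∑ i, ∑ j, A i j ^ 2 :=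
  Real.sq_sqrt (Finset.sum_nonneg fun _ _ => Finset.sum_nonneg fun _ _ => sq_nonneg _)

lemma measurable_vnorm {n : ℕ} : Measurable (vnorm : (Fin n → ℝ) → ℝ) := by
  unfold vnorm
  fun_prop

lemma measurable_frob {n d : ℕ} : Measurable (frob : (Fin n → Fin d → ℝ) → ℝ) := by
  unfold frob
  fun_prop

lemma abs_vdot_le {n : ℕ} (x y : Fin n → ℝ) : |vdot x y| ≤ vnorm x * vnorm y := by
  apply abs_le_of_sq_le_sq _ (mul_nonneg (vnorm_nonneg x) (vnorm_nonneg y))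
  rw [mul_pow, vnorm_sq, vnorm_sq]
  exact Finset.sum_mul_sq_le_sq_mul_sq _ _ _

lemma vnorm_add_sq {n : ℕ} (x y : Fin n → ℝ) :
    vnorm (x + y) ^ 2 = vnorm x ^ 2 + vnorm y ^ 2 + 2 * vdot x y := by
  simp only [vnorm_sq, vdot, Pi.add_apply, Finset.mul_sum, ← Finset.sum_add_distrib]
  exact Finset.sum_congr rfl fun i _ => by ring

lemma vdot_neg_right {n : ℕ} (x y : Fin n → ℝ) : vdot x (-y) = -vdot x y := by
  simp [vdot]

lemma vdot_smul_right {n : ℕ} (x y : Fin n → ℝ) (c : ℝ) : vdot x (c • y) = c * vdot x y := by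
  simp only [vdot, Pi.smul_apply, smul_eq_mul, Finset.mul_sum]
  exact Finset.sum_congr rfl fun i _ => by ring

lemma vnorm_neg {n : ℕ} (x : Fin n → ℝ) : vnorm (-x) = vnorm x := by
  simp [vnorm]

lemma vnorm_smul {n : ℕ} (c : ℝ) (x : Fin n → ℝ) : vnorm (c • x) = |c| * vnorm x := by
  simp only [vnorm, Pi.smul_apply, smul_eq_mul, mul_pow, ← Finset.mul_sum]
  rw [Real.sqrt_mul (sq_nonneg c), Real.sqrt_sq_eq_abs]

lemma mulv_neg {n d : ℕ} (A : Fin n → Fin d → ℝ) (w : Fin d → ℝ) :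
    mulv A (-w) = -mulv A w := by
  ext i
  simp [mulv]

lemma vnorm_mulv_le {n d : ℕ} (A : Fin n → Fin d → ℝ) (w : Fin d → ℝ) :
    vnorm (mulv A w) ≤ frob A * vnorm w := by
  apply le_of_sq_le_sq _ (mul_nonneg (frob_nonneg A) (vnorm_nonneg w))
  rw [mul_pow, vnorm_sq, vnorm_sq, frob_sq, Finset.sum_mul]
  exact Finset.sum_le_sum fun i _ => Finset.sum_mul_sq_le_sq_mul_sq _ _ _

lemma measurable_mulv {n d : ℕ} :
    Measurable fun q : (Fin n → Fin d → ℝ) × (Fin d → ℝ) => mulv q.1 q.2 := by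
  unfold mulv
  fun_prop

/-- `t ↦ (s + t) ^ m + (s - t) ^ m` is monotone in `|t|` on `[0, s]`. -/
lemma add_pow_add_sub_pow_le {s t τ : ℝ} (m : ℕ) (ht : |t| ≤ τ) (hτ : τ ≤ s) :
    (s + t) ^ m + (s - t) ^ m ≤ (s + τ) ^ m + (s - τ) ^ m := by
  obtain ⟨h1, h2⟩ := abs_le.mp ht
  rcases (by linarith : 0 ≤ τ).eq_or_lt with h0 | h0
  · have : t = 0 := by linarith
    simp [this, ← h0]
  have key : ∀ r : ℝ, |r| ≤ τ → (s + r) ^ m ≤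
      (τ + r) / (2 * τ) * (s + τ) ^ m + (τ - r) / (2 * τ) * (s - τ) ^ m := by
    intro r hr
    obtain ⟨h3, h4⟩ := abs_le.mp hr
    have := (convexOn_pow m).2 (show s + τ ∈ Ici (0 : ℝ) by simp only [mem_Ici]; linarith)
      (show s - τ ∈ Ici (0 : ℝ) by simp only [mem_Ici]; linarith)
      (show 0 ≤ (τ + r) / (2 * τ) from div_nonneg (by linarith) (by linarith))
      (show 0 ≤ (τ - r) / (2 * τ) from div_nonneg (by linarith) (by linarith))
      (by field_simp; ring)
    simp only [smul_eq_mul] at this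
    convert! this using 2
    field_simp
    ring
  have k1 := key t ht
  have k2 := key (-t) (by rwa [abs_neg])
  have e : (τ + t) / (2 * τ) + (τ - t) / (2 * τ) = 1 := by field_simp; ring
  have e' : (τ - t) / (2 * τ) = 1 - (τ + t) / (2 * τ) := by linarith
  simp only [← sub_eq_add_neg, sub_neg_eq_add] at k2
  rw [e'] at k1 k2
  linarith

lemma sum_range_two_mul_add_one (f : ℕ → ℝ) (m : ℕ) :
    ∑ i ∈ Finset.range (2 * m + 1), f i =
      ∑ k ∈ Finset.range (m + 1), f (2 * k) + ∑ k ∈ Finset.range m, f (2 * k + 1) := by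
  induction m with
  | zero => simp
  | succ m ih =>
    rw [show 2 * (m + 1) + 1 = (2 * m + 1) + 1 + 1 by ring, Finset.sum_range_succ,
      Finset.sum_range_succ, ih, Finset.sum_range_succ _ (m + 1),
      Finset.sum_range_succ (fun k => f (2 * k + 1)) m]
    rw [show 2 * (m + 1) = 2 * m + 1 + 1 by ring]
    ring

lemma add_pow_add_sub_pow_two_mul (a b : ℝ) (m : ℕ) :
    (b + a) ^ (2 * m) + (-b + a) ^ (2 * m) = 2 * ∑ k ∈ Finset.range (m + 1),
      ((2 * m).choose (2 * k) : ℝ) * (a ^ 2) ^ (m - k) * (b ^ 2) ^ k := by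
  rw [add_pow, add_pow, ← Finset.sum_add_distrib, sum_range_two_mul_add_one, Finset.mul_sum]
  have h1 : ∀ k, (-b) ^ (2 * k + 1) = -b ^ (2 * k + 1) := fun k => by
    rw [Odd.neg_pow ⟨k, rfl⟩]
  have h2 : ∀ k, (-b) ^ (2 * k) = b ^ (2 * k) := fun k => by
    rw [Even.neg_pow (by simp)]
  simp only [h1, h2, neg_mul, add_neg_cancel, Finset.sum_const_zero, add_zero]
  refine Finset.sum_congr rfl fun k _ => ?_
  rw [← pow_mul, ← pow_mul, ← Nat.mul_sub]
  ring

/-- The symmetrized even powers of `|x ± y|` are bounded by their value for parallel vectors. -/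
lemma vnorm_pow_symm_le {n : ℕ} (x y : Fin n → ℝ) (m : ℕ) :
    vnorm (x + y) ^ (2 * m) + vnorm (x + -y) ^ (2 * m) ≤ 2 * ∑ k ∈ Finset.range (m + 1),
      ((2 * m).choose (2 * k) : ℝ) * (vnorm x ^ 2) ^ (m - k) * (vnorm y ^ 2) ^ k := by
  rw [← add_pow_add_sub_pow_two_mul, pow_mul, pow_mul, vnorm_add_sq, vnorm_add_sq, vnorm_neg,
    vdot_neg_right]
  have h := add_pow_add_sub_pow_le (s := vnorm x ^ 2 + vnorm y ^ 2) (t := 2 * vdot x y)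
    (τ := 2 * (vnorm x * vnorm y)) m
    (by rw [abs_mul, abs_two]; linarith [abs_vdot_le x y])
    (by nlinarith [sq_nonneg (vnorm x - vnorm y)])
  rw [pow_mul, pow_mul]
  convert! h using 3 <;> ring

/-- First-order expansion of `(X + r) ^ (m + 1)` with a remainder quadratic in the step size. -/
lemma exists_pow_succ_expansion (c : ℝ) (m : ℕ) : ∃ C : ℝ, 0 ≤ C ∧
    ∀ X r h S : ℝ, 0 ≤ X → 0 ≤ X + r → X ≤ S → |r| ≤ c * h * S → 0 ≤ h → h ≤ 1 →
      (X + r) ^ (m + 1) ≤ X ^ (m + 1) + (m + 1) * X ^ m * r + C * h ^ 2 * S ^ (m + 1) := by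
  induction m with
  | zero =>
    refine ⟨0, le_rfl, fun X r h S _ _ _ _ _ _ => ?_⟩
    simp
  | succ m ih =>
    obtain ⟨C, hC, ih⟩ := ih
    refine ⟨(m + 1) * c ^ 2 + C * (1 + |c|), by positivity,
      fun X r h S hX hXr hXS hr h0 h1 => ?_⟩
    have hS : 0 ≤ S := hX.trans hXS
    have a1 := mul_le_mul_of_nonneg_right (ih X r h S hX hXr hXS hr h0 h1) hXr
    have a2 : r ^ 2 ≤ c ^ 2 * h ^ 2 * S ^ 2 := by
      have := pow_le_pow_left₀ (abs_nonneg r) hr 2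
      rw [sq_abs] at this
      linarith [mul_pow (c * h) S 2, mul_pow c h 2]
    have a3 : X ^ m * r ^ 2 ≤ S ^ m * (c ^ 2 * h ^ 2 * S ^ 2) := by gcongr
    have a4 : X + r ≤ (1 + |c|) * S := by
      have : c * h * S ≤ |c| * S := by
        have : c * h ≤ |c| := by
          nlinarith [le_abs_self c, abs_nonneg c]
        gcongr
      linarith [le_abs_self r]
    have a5 : C * h ^ 2 * S ^ (m + 1) * (X + r) ≤ C * h ^ 2 * S ^ (m + 1) * ((1 + |c|) * S) := by
      gcongr
    have a6 : ((m : ℝ) + 1) * (X ^ m * r ^ 2) ≤ (m + 1) * (S ^ m * (c ^ 2 * h ^ 2 * S ^ 2)) := by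
      gcongr
    push_cast
    calc (X + r) ^ (m + 1 + 1) = (X + r) ^ (m + 1) * (X + r) := pow_succ _ _
      _ ≤ _ := a1
      _ = X ^ (m + 1 + 1) + (m + 1 + 1) * X ^ (m + 1) * r + (m + 1) * (X ^ m * r ^ 2)
          + C * h ^ 2 * S ^ (m + 1) * (X + r) := by ring
      _ ≤ X ^ (m + 1 + 1) + (m + 1 + 1) * X ^ (m + 1) * r
          + (m + 1) * (S ^ m * (c ^ 2 * h ^ 2 * S ^ 2))
          + C * h ^ 2 * S ^ (m + 1) * ((1 + |c|) * S) := by linarith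
      _ = _ := by ring

lemma exists_pow_le_add (c : ℝ) (m : ℕ) : ∃ C : ℝ, 0 ≤ C ∧
    ∀ X r h S : ℝ, 0 ≤ X → 0 ≤ X + r → X ≤ S → |r| ≤ c * h * S → 0 ≤ h → h ≤ 1 →
      (X + r) ^ m ≤ X ^ m + C * h * S ^ m := by
  cases m with
  | zero => exact ⟨0, le_rfl, fun X r h S _ _ _ _ _ _ => by simp⟩
  | succ m =>
    obtain ⟨C, hC, H⟩ := exists_pow_succ_expansion c m
    refine ⟨(m + 1) * |c| + C, by positivity, fun X r h S hX hXr hXS hr h0 h1 => ?_⟩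
    have hS : 0 ≤ S := hX.trans hXS
    have a1 := H X r h S hX hXr hXS hr h0 h1
    have a2 : r ≤ |c| * h * S := by
      refine (le_abs_self r).trans (hr.trans ?_)
      gcongr
      exact le_abs_self c
    have a3 : X ^ m * r ≤ S ^ m * (|c| * h * S) :=
      (mul_le_mul_of_nonneg_left a2 (by positivity)).trans
        (mul_le_mul_of_nonneg_right (by gcongr) (by positivity))
    have a4 : C * h ^ 2 * S ^ (m + 1) ≤ C * h * S ^ (m + 1) := by
      gcongr
      nlinarith
    have a5 := mul_le_mul_of_nonneg_left a3 (by positivity : (0 : ℝ) ≤ m + 1)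
    calc _ ≤ _ := a1
      _ = X ^ (m + 1) + (m + 1) * (X ^ m * r) + C * h ^ 2 * S ^ (m + 1) := by ring
      _ ≤ X ^ (m + 1) + (m + 1) * (S ^ m * (|c| * h * S)) + C * h * S ^ (m + 1) := by linarith
      _ = _ := by ring

lemma one_add_add_pow_le {a b : ℝ} (ha : 0 ≤ a) (hb : 0 ≤ b) (m : ℕ) :
    (1 + a + b) ^ m ≤ 3 ^ m * (1 + a ^ m + b ^ m) := by
  have ham := pow_nonneg ha m
  have hbm := pow_nonneg hb m
  obtain ⟨M, hM, hM'⟩ : ∃ M : ℝ, (1 ≤ M ∧ a ≤ M ∧ b ≤ M) ∧ M ^ m ≤ 1 + a ^ m + b ^ m := by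
    refine ⟨max 1 (max a b), ⟨by simp, by simp, by simp⟩, ?_⟩
    rcases max_choice 1 (max a b) with h | h <;> rw [h]
    · rw [one_pow]
      linarith
    · rcases max_choice a b with h' | h' <;> rw [h'] <;> linarith
  calc (1 + a + b) ^ m ≤ (3 * M) ^ m := by gcongr; linarith
    _ = 3 ^ m * M ^ m := mul_pow _ _ _
    _ ≤ _ := by gcongr

/-- Conditional expectation given `X` of a function of `X` and of an independent variable:
the latter is integrated out. -/
lemma condExp_prod_ae_eq_integral_map {Ω β E : Type*} [MeasurableSpace E] [StandardBorelSpace E]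
    [Nonempty E] {mΩ : MeasurableSpace Ω} {mβ : MeasurableSpace β} {P : Measure Ω}
    [IsProbabilityMeasure P] {X : Ω → β} {W : Ω → E} (hX : Measurable X) (hW : Measurable W)
    (hind : ProbabilityTheory.IndepFun X W P) {f : β × E → ℝ} (hf : Measurable f)
    (hint : Integrable (fun ω => f (X ω, W ω)) P) :
    P[fun ω => f (X ω, W ω) | mβ.comap X] =ᵐ[P] fun ω => ∫ w, f (X ω, w) ∂(P.map W) := by
  have : IsProbabilityMeasure (P.map W) := Measure.isProbabilityMeasure_map hW.aemeasurable
  have : IsProbabilityMeasure (P.map X) := Measure.isProbabilityMeasure_map hX.aemeasurable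
  have h1 := ProbabilityTheory.condExp_prod_ae_eq_integral_condDistrib hX hW.aemeasurable
    hf.stronglyMeasurable hint
  have h2 : ProbabilityTheory.condDistrib W X P =ᵐ[P.map X]
      ProbabilityTheory.Kernel.const β (P.map W) := by
    apply ProbabilityTheory.condDistrib_ae_eq_of_measure_eq_compProd X hW.aemeasurable
    rw [Measure.compProd_const,
      (ProbabilityTheory.indepFun_iff_map_prod_eq_prod_map_map hX.aemeasurable
        hW.aemeasurable).mp hind]
  filter_upwards [h1, ae_of_ae_map hX.aemeasurable h2] with ω hω1 hω2
  rw [hω1, hω2, ProbabilityTheory.Kernel.const_apply]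

/-- The law `N(0, v I_d)`. -/
def gaussianPi (d : ℕ) (v : NNReal) : Measure (Fin d → ℝ) :=
  Measure.pi fun _ : Fin d => ProbabilityTheory.gaussianReal 0 v

instance (d : ℕ) (v : NNReal) : IsProbabilityMeasure (gaussianPi d v) := by
  unfold gaussianPi
  infer_instance

lemma measurePreserving_eval_gaussianPi {d : ℕ} (v : NNReal) (j : Fin d) :
    MeasurePreserving (fun w : Fin d → ℝ => w j) (gaussianPi d v)
      (ProbabilityTheory.gaussianReal 0 v) :=
  measurePreserving_eval (fun _ : Fin d => ProbabilityTheory.gaussianReal 0 v) j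

lemma measurePreserving_neg_gaussianPi (d : ℕ) (v : NNReal) :
    MeasurePreserving (fun w : Fin d → ℝ => -w) (gaussianPi d v) (gaussianPi d v) :=
  measurePreserving_pi _ _ fun _ =>
    ⟨measurable_neg, ProbabilityTheory.gaussianReal_map_neg.trans (by rw [neg_zero])⟩

lemma measurePreserving_smul_gaussianPi (d : ℕ) {Δ : ℝ} (hΔ : 0 ≤ Δ) :
    MeasurePreserving (fun w : Fin d → ℝ => Real.sqrt Δ • w) (gaussianPi d 1)
      (gaussianPi d Δ.toNNReal) := by
  refine measurePreserving_pi _ _ fun _ => ⟨measurable_const_mul _, ?_⟩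
  change Measure.map (fun x => Real.sqrt Δ * x) _ = _
  rw [ProbabilityTheory.gaussianReal_map_const_mul, mul_zero]
  congr 1
  ext
  simp [Real.sq_sqrt hΔ, hΔ]

lemma integrable_vnorm_sq_pow_gaussianPi (d : ℕ) (v : NNReal) (k : ℕ) :
    Integrable (fun w : Fin d → ℝ => (vnorm w ^ 2) ^ k) (gaussianPi d v) := by
  rcases Nat.eq_zero_or_pos k with rfl | hk
  · simp
  have hw : ∀ j, MemLp (fun w : Fin d → ℝ => w j ^ 2) (k : ENNReal) (gaussianPi d v) := fun j => by
    have h : MemLp (fun w : Fin d → ℝ => w j) ((2 : ℕ) * k : ENNReal) (gaussianPi d v) :=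
      (ProbabilityTheory.memLp_id_gaussianReal' ((2 : ℕ) * k : ENNReal)
        (by finiteness)).comp_measurePreserving
        (measurePreserving_eval_gaussianPi v j)
    have := h.norm_rpow_div (2 : ENNReal)
    have e : ((2 : ℕ) * k : ENNReal) / 2 = k := by
      rw [Nat.cast_ofNat, mul_comm]
      exact ENNReal.mul_div_cancel_right (by simp) (by simp)
    rw [e] at this
    simpa using this
  have hs := memLp_finsetSum Finset.univ fun j _ => hw j
  have := hs.integrable_norm_pow (by omega)
  refine this.congr (ae_of_all _ fun w => ?_)
  simp only [vnorm_sq, Real.norm_eq_abs]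
  rw [abs_of_nonneg (Finset.sum_nonneg fun _ _ => sq_nonneg _)]

lemma integral_vnorm_sq_pow_gaussianPi (d : ℕ) {Δ : ℝ} (hΔ : 0 ≤ Δ) (k : ℕ) :
    ∫ w, (vnorm w ^ 2) ^ k ∂gaussianPi d Δ.toNNReal =
      Δ ^ k * ∫ w, (vnorm w ^ 2) ^ k ∂gaussianPi d 1 := by
  have h := measurePreserving_smul_gaussianPi d hΔ
  rw [← h.map_eq, integral_map h.measurable.aemeasurable
    ((measurable_vnorm.pow_const 2).pow_const k).aestronglyMeasurable, ← integral_const_mul]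
  congr 1
  ext w
  rw [vnorm_smul, mul_pow, sq_abs, Real.sq_sqrt hΔ, mul_pow]

lemma integral_vnorm_mulv_sq_gaussianPi {n d : ℕ} (v : NNReal) (A : Fin n → Fin d → ℝ) :
    ∫ w, vnorm (mulv A w) ^ 2 ∂gaussianPi d v = v * frob A ^ 2 := by
  have hL : ∀ j, MemLp (fun w : Fin d → ℝ => w j) 2 (gaussianPi d v) := fun j =>
    (ProbabilityTheory.memLp_id_gaussianReal' 2 (by simp)).comp_measurePreserving
      (measurePreserving_eval_gaussianPi v j)
  have hLi : ∀ i, MemLp (fun w : Fin d → ℝ => mulv A w i) 2 (gaussianPi d v) := fun i =>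
    memLp_finsetSum Finset.univ fun j _ => (hL j).const_mul (A i j)
  have hmean : ∀ j, ∫ w : Fin d → ℝ, w j ∂gaussianPi d v = 0 := fun j => by
    rw [← ProbabilityTheory.integral_id_gaussianReal (μ := 0) (v := v),
      ← (measurePreserving_eval_gaussianPi v j).map_eq]
    exact (integral_map (φ := fun w : Fin d → ℝ => w j) (f := fun y : ℝ => y)
      (measurable_pi_apply j).aemeasurable measurable_id.aestronglyMeasurable).symm
  have hvar : ∀ i, ∫ w, mulv A w i ^ 2 ∂gaussianPi d v = v * ∑ j, A i j ^ 2 := fun i => by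
    have h0 : ∫ w, mulv A w i ∂gaussianPi d v = 0 := by
      unfold mulv
      rw [integral_finsetSum _ fun j _ => ((hL j).integrable (by simp)).const_mul _]
      simp [integral_const_mul, hmean]
    rw [← ProbabilityTheory.variance_of_integral_eq_zero (hLi i).aemeasurable h0]
    have := ProbabilityTheory.variance_sum_pi
      (μ := fun _ : Fin d => ProbabilityTheory.gaussianReal 0 v)
      (X := fun j (x : ℝ) => A i j * x)
      (fun j => (ProbabilityTheory.memLp_id_gaussianReal' 2 (by simp)).const_mul (A i j))
    have e : (fun w : Fin d → ℝ => mulv A w i) = ∑ j, fun w : Fin d → ℝ => A i j * w j := by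
      ext w
      simp [mulv]
    rw [e]
    refine this.trans ?_
    rw [Finset.mul_sum]
    refine Finset.sum_congr rfl fun j _ => ?_
    rw [ProbabilityTheory.variance_const_mul, mul_comm]
    congr 1
    exact ProbabilityTheory.variance_id_gaussianReal
  simp only [vnorm_sq]
  rw [integral_finsetSum _ fun i _ => (hLi i).integrable_sq, frob_sq, Finset.mul_sum]
  exact Finset.sum_congr rfl fun i _ => hvar i

lemma integrable_vnorm_mulv_sq_pow_gaussianPi {n d : ℕ} (v : NNReal) (A : Fin n → Fin d → ℝ)
    (k : ℕ) : Integrable (fun w => (vnorm (mulv A w) ^ 2) ^ k) (gaussianPi d v) := by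
  have hm : Measurable fun w => mulv A w := measurable_mulv.comp measurable_prodMk_left
  refine ((integrable_vnorm_sq_pow_gaussianPi d v k).const_mul ((frob A ^ 2) ^ k)).mono'
    (((measurable_vnorm.comp hm).pow_const 2).pow_const k).aestronglyMeasurable
    (ae_of_all _ fun w => ?_)
  rw [Real.norm_of_nonneg (by positivity), ← mul_pow, ← mul_pow]
  gcongr
  · exact vnorm_nonneg _
  · exact vnorm_mulv_le A w

lemma integral_vnorm_mulv_sq_pow_le {n d : ℕ} {Δ : ℝ} (hΔ : 0 ≤ Δ) (A : Fin n → Fin d → ℝ)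
    (k : ℕ) : ∫ w, (vnorm (mulv A w) ^ 2) ^ k ∂gaussianPi d Δ.toNNReal ≤
      (frob A ^ 2 * Δ) ^ k * ∫ w, (vnorm w ^ 2) ^ k ∂gaussianPi d 1 := by
  rw [mul_pow, mul_assoc, ← integral_vnorm_sq_pow_gaussianPi d hΔ, ← integral_const_mul]
  refine integral_mono (integrable_vnorm_mulv_sq_pow_gaussianPi _ A k)
    ((integrable_vnorm_sq_pow_gaussianPi d _ k).const_mul _) fun w => ?_
  simp only [← mul_pow]
  gcongr
  · exact vnorm_nonneg _
  · exact vnorm_mulv_le A w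

lemma vnorm_add_pow_le {n : ℕ} (x y : Fin n → ℝ) (m : ℕ) :
    vnorm (x + y) ^ (2 * m) ≤ 2 * ∑ k ∈ Finset.range (m + 1),
      ((2 * m).choose (2 * k) : ℝ) * (vnorm x ^ 2) ^ (m - k) * (vnorm y ^ 2) ^ k :=
  (le_add_of_nonneg_right (pow_nonneg (vnorm_nonneg _) _)).trans (vnorm_pow_symm_le x y m)

/-- Even moments of a Gaussian vector with mean `u`, bounded by those in the parallel case. -/
lemma integral_vnorm_add_mulv_pow_le {n d : ℕ} (v : NNReal) (u : Fin n → ℝ)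
    (A : Fin n → Fin d → ℝ) (m : ℕ) :
    ∫ w, vnorm (u + mulv A w) ^ (2 * m) ∂gaussianPi d v ≤ ∑ k ∈ Finset.range (m + 1),
      ((2 * m).choose (2 * k) : ℝ) * (vnorm u ^ 2) ^ (m - k) *
        ∫ w, (vnorm (mulv A w) ^ 2) ^ k ∂gaussianPi d v := by
  have hm : Measurable fun w => vnorm (u + mulv A w) ^ (2 * m) :=
    (measurable_vnorm.comp
      ((measurable_mulv.comp measurable_prodMk_left).const_add u)).pow_const _
  have hterm : ∀ k ∈ Finset.range (m + 1), Integrable (fun w =>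
      ((2 * m).choose (2 * k) : ℝ) * (vnorm u ^ 2) ^ (m - k) * (vnorm (mulv A w) ^ 2) ^ k)
      (gaussianPi d v) := fun k _ => (integrable_vnorm_mulv_sq_pow_gaussianPi v A k).const_mul _
  have hsum := (integrable_finsetSum _ hterm).const_mul 2
  have hi : Integrable (fun w => vnorm (u + mulv A w) ^ (2 * m)) (gaussianPi d v) := by
    refine hsum.mono' hm.aestronglyMeasurable (ae_of_all _ fun w => ?_)
    rw [Real.norm_of_nonneg (pow_nonneg (vnorm_nonneg _) _)]
    exact vnorm_add_pow_le u (mulv A w) m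
  have hneg := measurePreserving_neg_gaussianPi d v
  have hi' : Integrable (fun w => vnorm (u + -mulv A w) ^ (2 * m)) (gaussianPi d v) := by
    simpa only [Function.comp_def, mulv_neg] using hneg.integrable_comp_of_integrable hi
  have hsymm : ∫ w, vnorm (u + -mulv A w) ^ (2 * m) ∂gaussianPi d v =
      ∫ w, vnorm (u + mulv A w) ^ (2 * m) ∂gaussianPi d v := by
    conv_rhs => rw [← hneg.map_eq,
      integral_map hneg.measurable.aemeasurable hm.aestronglyMeasurable]
    simp only [mulv_neg]
  have h := integral_mono (hi.add hi') hsum fun w => vnorm_pow_symm_le u (mulv A w) m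
  simp only [Pi.add_apply] at h
  rw [integral_add hi hi', hsymm, integral_const_mul, integral_finsetSum _ hterm] at h
  simp only [integral_const_mul] at h
  linarith

lemma abs_two_mul_vdot_le {n : ℕ} {L h Δ M : ℝ} (hL : 0 ≤ L) (h0 : 0 ≤ h) (hΔ : 0 ≤ Δ)
    (hM : 0 ≤ M) (x F : Fin n → ℝ) (hF : Δ ^ 2 * vnorm F ^ 2 ≤ L ^ 2 * h ^ 2 * (1 + M)) :
    |2 * vdot x F * Δ| ≤ L * h * (1 + vnorm x ^ 2 + M) := by
  have h1 : |2 * vdot x F * Δ| ≤ 2 * (vnorm x * vnorm F) * Δ := by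
    rw [abs_mul, abs_mul, abs_two, abs_of_nonneg hΔ]
    gcongr
    exact abs_vdot_le x F
  refine h1.trans (le_of_sq_le_sq ?_ (by positivity))
  calc (2 * (vnorm x * vnorm F) * Δ) ^ 2 = 4 * vnorm x ^ 2 * (Δ ^ 2 * vnorm F ^ 2) := by ring
    _ ≤ 4 * vnorm x ^ 2 * (L ^ 2 * h ^ 2 * (1 + M)) := by gcongr
    _ = L ^ 2 * h ^ 2 * (4 * vnorm x ^ 2 * (1 + M)) := by ring
    _ ≤ L ^ 2 * h ^ 2 * (1 + vnorm x ^ 2 + M) ^ 2 := by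
      gcongr
      nlinarith [sq_nonneg (vnorm x ^ 2 - (1 + M))]
    _ = _ := by ring

lemma vnorm_add_smul_sq {n : ℕ} (x F : Fin n → ℝ) (Δ : ℝ) :
    vnorm (x + Δ • F) ^ 2 =
      vnorm x ^ 2 + (2 * vdot x F * Δ + Δ ^ 2 * vnorm F ^ 2) := by
  rw [vnorm_add_sq, vdot_smul_right, vnorm_smul, mul_pow, sq_abs]
  ring

lemma abs_drift_increment_le {n : ℕ} {L h Δ M : ℝ} (hL : 0 ≤ L) (h0 : 0 ≤ h) (h1 : h ≤ 1)
    (hΔ : 0 ≤ Δ) (hM : 0 ≤ M) (x F : Fin n → ℝ)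
    (hF : Δ ^ 2 * vnorm F ^ 2 ≤ L ^ 2 * h ^ 2 * (1 + M)) :
    |2 * vdot x F * Δ + Δ ^ 2 * vnorm F ^ 2| ≤ (L + L ^ 2) * h * (1 + vnorm x ^ 2 + M) := by
  have a1 := abs_two_mul_vdot_le hL h0 hΔ hM x F hF
  have a2 : L ^ 2 * h ^ 2 * (1 + M) ≤ L ^ 2 * h * (1 + vnorm x ^ 2 + M) := by
    have : h ^ 2 ≤ h := by nlinarith
    have := sq_nonneg (vnorm x)
    gcongr
    linarith
  calc _ ≤ |2 * vdot x F * Δ| + |Δ ^ 2 * vnorm F ^ 2| := abs_add_le _ _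
    _ ≤ L * h * (1 + vnorm x ^ 2 + M) + L ^ 2 * h * (1 + vnorm x ^ 2 + M) := by
      rw [abs_of_nonneg (by positivity : 0 ≤ Δ ^ 2 * vnorm F ^ 2)]
      linarith
    _ = _ := by ring

lemma vnorm_add_smul_sq_le {n : ℕ} {L h Δ M : ℝ} (hL : 0 ≤ L) (h0 : 0 ≤ h) (h1 : h ≤ 1)
    (hΔ : 0 ≤ Δ) (hM : 0 ≤ M) (x F : Fin n → ℝ)
    (hF : Δ ^ 2 * vnorm F ^ 2 ≤ L ^ 2 * h ^ 2 * (1 + M)) :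
    vnorm (x + Δ • F) ^ 2 ≤ (1 + L + L ^ 2) * (1 + vnorm x ^ 2 + M) := by
  have a1 := (le_abs_self _).trans (abs_drift_increment_le hL h0 h1 hΔ hM x F hF)
  have a2 : (L + L ^ 2) * h * (1 + vnorm x ^ 2 + M) ≤
      (L + L ^ 2) * 1 * (1 + vnorm x ^ 2 + M) := by gcongr
  rw [vnorm_add_smul_sq]
  linarith

lemma higher_moment_term_le {n d : ℕ} {L h Δ S U a b : ℝ} {A : Fin n → Fin d → ℝ} {j p : ℕ}
    (hL : 0 ≤ L) (h0 : 0 ≤ h) (h1 : h ≤ 1) (hΔ : 0 ≤ Δ) (ha : 0 ≤ a) (hS : 0 ≤ S)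
    (hU : U ^ 2 ≤ b * S) (hA : frob A ^ 2 * Δ ≤ L * h * S) (hj : 2 ≤ j) (hjp : j ≤ p) :
    a * (U ^ 2) ^ (p - j) * ∫ w, (vnorm (mulv A w) ^ 2) ^ j ∂gaussianPi d Δ.toNNReal ≤
      a * b ^ (p - j) * (L ^ j * ∫ w, (vnorm w ^ 2) ^ j ∂gaussianPi d 1) *
        (h ^ 2 * S ^ p) := by
  have hc : 0 ≤ ∫ w, (vnorm w ^ 2) ^ j ∂gaussianPi d 1 :=
    integral_nonneg fun w => by positivity
  have i1 := integral_vnorm_mulv_sq_pow_le hΔ A j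
  generalize (∫ w, (vnorm w ^ 2) ^ j ∂gaussianPi d 1) = c at hc i1 ⊢
  have i2 : (frob A ^ 2 * Δ) ^ j ≤ L ^ j * h ^ 2 * S ^ j := by
    calc (frob A ^ 2 * Δ) ^ j ≤ (L * h * S) ^ j := by gcongr
      _ = L ^ j * h ^ j * S ^ j := by rw [mul_pow, mul_pow]
      _ ≤ _ := by
        gcongr ?_ * ?_ * ?_
        exact pow_le_pow_of_le_one h0 h1 hj
  calc _ ≤ a * (b * S) ^ (p - j) * (L ^ j * h ^ 2 * S ^ j * c) := by
        have hbS : 0 ≤ b * S := (sq_nonneg U).trans hU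
        refine mul_le_mul (mul_le_mul_of_nonneg_left (pow_le_pow_left₀ (sq_nonneg U) hU _) ha)
          (i1.trans (mul_le_mul_of_nonneg_right i2 hc))
          (integral_nonneg fun w => by positivity) (by positivity)
    _ = a * b ^ (p - j) * (L ^ j * c) * (h ^ 2 * (S ^ (p - j) * S ^ j)) := by
      rw [mul_pow]
      ring
    _ = _ := by rw [← pow_add, Nat.sub_add_cancel hjp]

/-- Deterministic one-step estimate, with a remainder quadratic in the effective step size `h`. -/
lemma exists_integral_step_le (q n d : ℕ) {L : ℝ} (hL : 0 ≤ L) : ∃ C : ℝ, 0 ≤ C ∧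
    ∀ (h Δ M : ℝ) (x F : Fin n → ℝ) (A : Fin n → Fin d → ℝ),
      0 ≤ h → h ≤ 1 → 0 ≤ Δ → 0 ≤ M →
      Δ ^ 2 * vnorm F ^ 2 ≤ L ^ 2 * h ^ 2 * (1 + M) → frob A ^ 2 * Δ ≤ L * h * (1 + M) →
      ∫ w, vnorm (x + Δ • F + mulv A w) ^ (2 * (q + 1)) ∂gaussianPi d Δ.toNNReal ≤
        (vnorm x ^ 2) ^ (q + 1) + (q + 1) * (vnorm x ^ 2) ^ q *
          (2 * vdot x F + (2 * (q + 1) - 1) * frob A ^ 2) * Δ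
          + C * h ^ 2 * (1 + vnorm x ^ 2 + M) ^ (q + 1) := by
  obtain ⟨C₁, hC₁, H₁⟩ := exists_pow_succ_expansion (L + L ^ 2) q
  obtain ⟨C₂, hC₂, H₂⟩ := exists_pow_le_add (L + L ^ 2) q
  set c : ℕ → ℝ := fun k => ∫ w, (vnorm w ^ 2) ^ k ∂gaussianPi d 1
  have hc0 : ∀ k, 0 ≤ c k := fun k => integral_nonneg fun w => by positivity
  set D : ℕ → ℝ := fun k => ((2 * (q + 1)).choose (2 * (k + 1 + 1)) : ℝ) *
    (1 + L + L ^ 2) ^ (q + 1 - (k + 1 + 1)) * (L ^ (k + 1 + 1) * c (k + 1 + 1))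
  have hD0 : ∀ k, 0 ≤ D k := fun k => by
    have := hc0 (k + 1 + 1)
    positivity
  refine ⟨C₁ + (q + 1) * L ^ 2 + (q + 1) * (2 * (q + 1) - 1) * C₂ * L
    + ∑ k ∈ Finset.range q, D k, ?_, ?_⟩
  · have : (0 : ℝ) ≤ 2 * (q + 1) - 1 := by linarith [(Nat.cast_nonneg q : (0 : ℝ) ≤ q)]
    have := Finset.sum_nonneg fun k (_ : k ∈ Finset.range q) => hD0 k
    positivity
  intro h Δ M x F A h0 h1 hΔ hM hF hA
  have hq : (0 : ℝ) ≤ 2 * (q + 1) - 1 := by linarith [(Nat.cast_nonneg q : (0 : ℝ) ≤ q)]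
  have hX : 0 ≤ vnorm x ^ 2 := sq_nonneg _
  have hr := abs_drift_increment_le hL h0 h1 hΔ hM x F hF
  have hU := vnorm_add_smul_sq_le hL h0 h1 hΔ hM x F hF
  have hUe := vnorm_add_smul_sq x F Δ
  have hU0 : 0 ≤ vnorm (x + Δ • F) ^ 2 := sq_nonneg _
  set S := 1 + vnorm x ^ 2 + M with hS
  have hS0 : 0 ≤ S := by positivity
  have hXS : vnorm x ^ 2 ≤ S := by linarith
  have hAS : frob A ^ 2 * Δ ≤ L * h * S :=
    hA.trans (mul_le_mul_of_nonneg_left (by linarith) (by positivity))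
  have hFS : Δ ^ 2 * vnorm F ^ 2 ≤ L ^ 2 * h ^ 2 * S :=
    hF.trans (mul_le_mul_of_nonneg_left (by linarith) (by positivity))
  have hA0 : 0 ≤ frob A ^ 2 * Δ := by positivity
  refine (integral_vnorm_add_mulv_pow_le Δ.toNNReal (x + Δ • F) A (q + 1)).trans ?_
  rw [Finset.sum_range_succ', Finset.sum_range_succ']
  have t0 := H₁ _ _ h S hX (hUe ▸ hU0) hXS hr h0 h1
  have t1 := H₂ _ _ h S hX (hUe ▸ hU0) hXS hr h0 h1
  rw [← hUe] at t0 t1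
  have t0' : (q + 1) * (vnorm x ^ 2) ^ q * (Δ ^ 2 * vnorm F ^ 2) ≤
      (q + 1) * L ^ 2 * h ^ 2 * S ^ (q + 1) := by
    calc _ ≤ (q + 1) * S ^ q * (L ^ 2 * h ^ 2 * S) := by gcongr
      _ = _ := by ring
  have t1' : (vnorm (x + Δ • F) ^ 2) ^ q * (frob A ^ 2 * Δ) ≤
      (vnorm x ^ 2) ^ q * (frob A ^ 2 * Δ) + C₂ * L * h ^ 2 * S ^ (q + 1) := by
    calc _ ≤ ((vnorm x ^ 2) ^ q + C₂ * h * S ^ q) * (frob A ^ 2 * Δ) := by gcongr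
      _ = (vnorm x ^ 2) ^ q * (frob A ^ 2 * Δ) + C₂ * h * S ^ q * (frob A ^ 2 * Δ) := by ring
      _ ≤ (vnorm x ^ 2) ^ q * (frob A ^ 2 * Δ) + C₂ * h * S ^ q * (L * h * S) := by gcongr
      _ = _ := by ring
  have t1'' := mul_le_mul_of_nonneg_left t1'
    (by positivity : (0 : ℝ) ≤ (q + 1) * (2 * (q + 1) - 1))
  have t2 : ∑ k ∈ Finset.range q, ((2 * (q + 1)).choose (2 * (k + 1 + 1)) : ℝ) *
      (vnorm (x + Δ • F) ^ 2) ^ (q + 1 - (k + 1 + 1)) *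
        ∫ w, (vnorm (mulv A w) ^ 2) ^ (k + 1 + 1) ∂gaussianPi d Δ.toNNReal ≤
      (∑ k ∈ Finset.range q, D k) * (h ^ 2 * S ^ (q + 1)) := by
    rw [Finset.sum_mul]
    refine Finset.sum_le_sum fun k hk => ?_
    have hkq : k + 1 + 1 ≤ q + 1 := by
      have := Finset.mem_range.mp hk
      omega
    refine (higher_moment_term_le hL h0 h1 hΔ (Nat.cast_nonneg _) hS0 hU hAS
      (by omega) hkq).trans_eq ?_
    ring
  have hch : ((2 * (q + 1)).choose (2 * (0 + 1)) : ℝ) = (q + 1) * (2 * (q + 1) - 1) := by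
    rw [zero_add, mul_one, Nat.cast_choose_two]
    push_cast
    ring
  have hint : ∫ w, (vnorm (mulv A w) ^ 2) ^ (0 + 1) ∂gaussianPi d Δ.toNNReal =
      frob A ^ 2 * Δ := by
    simp only [zero_add, pow_one]
    rw [integral_vnorm_mulv_sq_gaussianPi, Real.coe_toNNReal _ hΔ, mul_comm]
  rw [hch, hint]
  simp only [mul_zero, Nat.choose_zero_right, Nat.cast_one, one_mul, pow_zero, Nat.sub_zero,
    zero_add, Nat.add_sub_cancel, integral_const, probReal_univ, smul_eq_mul, mul_one] at t2 ⊢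
  linarith

lemma integrable_vnorm_add_mulv_pow {Ω β : Type*} {n d : ℕ} {mΩ : MeasurableSpace Ω}
    {mβ : MeasurableSpace β} {P : Measure Ω} {v : NNReal} {X : Ω → β} {W : Ω → Fin d → ℝ}
    (hX : Measurable X) (hW : Measurable W) (hlaw : P.map W = gaussianPi d v)
    (hind : ProbabilityTheory.IndepFun X W P) {u : β → Fin n → ℝ} {A : β → Fin n → Fin d → ℝ}
    (hu : Measurable u) (hA : Measurable A) (m : ℕ)
    (hint : ∀ k ≤ m, Integrable
      (fun ω => (vnorm (u (X ω)) ^ 2) ^ (m - k) * (frob (A (X ω)) ^ 2) ^ k) P) :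
    Integrable (fun ω => vnorm (u (X ω) + mulv (A (X ω)) (W ω)) ^ (2 * m)) P := by
  have hWk : ∀ k, Integrable (fun ω => (vnorm (W ω) ^ 2) ^ k) P := fun k => by
    have h := integrable_vnorm_sq_pow_gaussianPi d v k
    rw [← hlaw] at h
    exact h.comp_measurable hW
  have hprod : ∀ k ∈ Finset.range (m + 1), Integrable (fun ω =>
      ((2 * m).choose (2 * k) : ℝ) * ((vnorm (u (X ω)) ^ 2) ^ (m - k) *
        (frob (A (X ω)) ^ 2) ^ k * (vnorm (W ω) ^ 2) ^ k)) P := fun k hk => by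
    have hφ : Measurable fun b => (vnorm (u b) ^ 2) ^ (m - k) * (frob (A b) ^ 2) ^ k :=
      (((measurable_vnorm.comp hu).pow_const 2).pow_const _).mul
        (((measurable_frob.comp hA).pow_const 2).pow_const _)
    have hψ : Measurable fun w : Fin d → ℝ => (vnorm w ^ 2) ^ k :=
      (measurable_vnorm.pow_const 2).pow_const k
    exact ((hind.comp hφ hψ).integrable_mul
      (hint k (Nat.lt_succ_iff.mp (Finset.mem_range.mp hk))) (hWk k)).const_mul _
  refine ((integrable_finsetSum _ hprod).const_mul 2).mono' ?_ (ae_of_all _ fun ω => ?_)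
  · exact ((measurable_vnorm.comp ((hu.comp hX).add
      (measurable_mulv.comp ((hA.comp hX).prodMk hW)))).pow_const _).aestronglyMeasurable
  rw [Real.norm_of_nonneg (pow_nonneg (vnorm_nonneg _) _)]
  refine (vnorm_add_pow_le _ _ m).trans ?_
  refine mul_le_mul_of_nonneg_left (Finset.sum_le_sum fun k _ => ?_) two_pos.le
  rw [mul_assoc, mul_assoc, ← mul_pow, ← mul_pow]
  gcongr
  · exact vnorm_nonneg _
  · exact vnorm_mulv_le _ _

/-- The one-step estimate, conditionally on a random variable `X` independent of the noise. -/
lemma exists_condExp_comap_step_le (q n d : ℕ) {L : ℝ} (hL : 0 ≤ L) : ∃ C : ℝ, 0 < C ∧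
    ∀ (Ω β : Type) (_mΩ : MeasurableSpace Ω) (mβ : MeasurableSpace β) (P : Measure Ω)
      [IsProbabilityMeasure P] (h Δ : ℝ), 0 ≤ h → h ≤ 1 → 0 < Δ → h ^ 2 ≤ Δ →
    ∀ (X : Ω → β) (W : Ω → Fin d → ℝ), Measurable X → Measurable W →
      P.map W = gaussianPi d Δ.toNNReal → ProbabilityTheory.IndepFun X W P →
    ∀ (x F : β → Fin n → ℝ) (A : β → Fin n → Fin d → ℝ) (M : β → ℝ),
      Measurable x → Measurable F → Measurable A → Measurable M → (∀ b, 0 ≤ M b) →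
      (∀ᵐ ω ∂P, Δ ^ 2 * vnorm (F (X ω)) ^ 2 ≤ L ^ 2 * h ^ 2 * (1 + M (X ω))) →
      (∀ᵐ ω ∂P, frob (A (X ω)) ^ 2 * Δ ≤ L * h * (1 + M (X ω))) →
      Integrable (fun ω => (vnorm (x (X ω)) ^ 2) ^ (q + 1)) P →
      Integrable (fun ω => M (X ω) ^ (q + 1)) P →
      ∀ᵐ ω ∂P, (P[fun ω' => vnorm (x (X ω') + Δ • F (X ω') + mulv (A (X ω')) (W ω')) ^
          (2 * (q + 1)) | mβ.comap X]) ω ≤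
        (vnorm (x (X ω)) ^ 2) ^ (q + 1) + (q + 1) * (vnorm (x (X ω)) ^ 2) ^ q *
          (2 * vdot (x (X ω)) (F (X ω)) + (2 * (q + 1) - 1) * frob (A (X ω)) ^ 2) * Δ
          + C * Δ * (1 + (vnorm (x (X ω)) ^ 2) ^ (q + 1) + M (X ω) ^ (q + 1)) := by
  obtain ⟨C, hC, H⟩ := exists_integral_step_le q n d hL
  refine ⟨C * 3 ^ (q + 1) + 1, by positivity, ?_⟩
  intro Ω β mΩ mβ P _ h Δ h0 h1 hΔ hhΔ X W hX hW hlaw hind x F A M hx hF hA hM hM0 hFb hAb hxi hMi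
  have hu : Measurable fun b => x b + Δ • F b := hx.add (hF.const_smul Δ)
  have hSint : Integrable (fun ω =>
      3 ^ (q + 1) * (1 + (vnorm (x (X ω)) ^ 2) ^ (q + 1) + M (X ω) ^ (q + 1))) P :=
    (((integrable_const 1).add hxi).add hMi).const_mul _
  have hint := integrable_vnorm_add_mulv_pow hX hW hlaw hind hu hA (q + 1) fun k hk => by
    refine (hSint.const_mul ((1 + L + L ^ 2) ^ (q + 1 - k) * (L * h / Δ) ^ k)).mono' ?_ ?_
    · exact ((((measurable_vnorm.comp (hu.comp hX)).pow_const 2).pow_const _).mul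
        (((measurable_frob.comp (hA.comp hX)).pow_const 2).pow_const _)).aestronglyMeasurable
    filter_upwards [hFb, hAb] with ω hω₁ hω₂
    have hMω := hM0 (X ω)
    set S := 1 + vnorm (x (X ω)) ^ 2 + M (X ω) with hS
    have hS0 : 0 ≤ S := by positivity
    have b1 := vnorm_add_smul_sq_le hL h0 h1 hΔ.le hMω (x (X ω)) (F (X ω)) hω₁
    have b2 : frob (A (X ω)) ^ 2 ≤ L * h / Δ * S := by
      rw [div_mul_eq_mul_div, le_div_iff₀ hΔ]
      exact hω₂.trans (mul_le_mul_of_nonneg_left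
        (by linarith [sq_nonneg (vnorm (x (X ω)))]) (by positivity))
    rw [Real.norm_of_nonneg (by positivity)]
    calc _ ≤ ((1 + L + L ^ 2) * S) ^ (q + 1 - k) * (L * h / Δ * S) ^ k := by gcongr
      _ = (1 + L + L ^ 2) ^ (q + 1 - k) * (L * h / Δ) ^ k * (S ^ (q + 1 - k) * S ^ k) := by
        rw [mul_pow, mul_pow]
        ring
      _ = (1 + L + L ^ 2) ^ (q + 1 - k) * (L * h / Δ) ^ k * S ^ (q + 1) := by
        rw [← pow_add, Nat.sub_add_cancel hk]
      _ ≤ _ := by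
        gcongr
        exact one_add_add_pow_le (sq_nonneg _) hMω _
  have hf : Measurable fun z : β × (Fin d → ℝ) =>
      vnorm (x z.1 + Δ • F z.1 + mulv (A z.1) z.2) ^ (2 * (q + 1)) :=
    (measurable_vnorm.comp ((hu.comp measurable_fst).add
      (measurable_mulv.comp ((hA.comp measurable_fst).prodMk measurable_snd)))).pow_const _
  have hcond := condExp_prod_ae_eq_integral_map hX hW hind hf hint
  filter_upwards [hcond, hFb, hAb] with ω hω hω₁ hω₂
  rw [hω, hlaw]
  refine (H h Δ _ _ _ _ h0 h1 hΔ.le (hM0 (X ω)) hω₁ hω₂).trans ?_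
  have hMω := hM0 (X ω)
  have hSle := one_add_add_pow_le (sq_nonneg (vnorm (x (X ω)))) hMω (q + 1)
  have : C * h ^ 2 * (1 + vnorm (x (X ω)) ^ 2 + M (X ω)) ^ (q + 1) ≤
      (C * 3 ^ (q + 1) + 1) * Δ *
        (1 + (vnorm (x (X ω)) ^ 2) ^ (q + 1) + M (X ω) ^ (q + 1)) := by
    calc _ ≤ C * Δ * (3 ^ (q + 1) *
          (1 + (vnorm (x (X ω)) ^ 2) ^ (q + 1) + M (X ω) ^ (q + 1))) := by gcongr
      _ = C * 3 ^ (q + 1) * Δ *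
          (1 + (vnorm (x (X ω)) ^ 2) ^ (q + 1) + M (X ω) ^ (q + 1)) := by ring
      _ ≤ _ := by
        gcongr
        linarith
  linarith

/-- One-step conditional moment estimate for the truncated Euler–Maruyama scheme:
if `W ~ N(0, Δ I_d)` is independent of `𝒢` and `x, F, G, M` are `𝒢`-measurable with
`|F|² ≤ L²Δ^{-2λ}(1+M)` and `|G|² ≤ LΔ^{-λ}(1+M)`, then almost surely
`E[|x + FΔ + GW|^{2p} | 𝒢] ≤ |x|^{2p} + p|x|^{2(p-1)}(2⟨x,F⟩ + (2p-1)|G|²)Δ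
  + CΔ(1 + |x|^{2p} + M^p)`, with `C` depending only on `p`, `n`, `d` and `L`. -/
theorem one_step_conditional_moment_bound
    (p n d : ℕ) (hp : 1 ≤ p) (L : ℝ) (hL : 0 ≤ L) :
    ∃ C : ℝ, 0 < C ∧
      ∀ (lam Δ : ℝ), 0 < lam → lam ≤ 1 / 2 → 0 < Δ → Δ ≤ 1 →
      ∀ (Ω : Type) (G : MeasurableSpace Ω) [mΩ : MeasurableSpace Ω]
        (P : Measure Ω) [IsProbabilityMeasure P], G ≤ mΩ →
      ∀ (W : Ω → Fin d → ℝ), Measurable W →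
        (Measure.map W P
          = Measure.pi fun _ : Fin d => ProbabilityTheory.gaussianReal 0 (Real.toNNReal Δ)) →
        (∀ s t : Set Ω, MeasurableSet[MeasurableSpace.comap W inferInstance] s →
          MeasurableSet[G] t → P (s ∩ t) = P s * P t) →
      ∀ (x F : Ω → Fin n → ℝ) (Gm : Ω → Fin n → Fin d → ℝ) (M : Ω → ℝ),
        Measurable[G] x → Measurable[G] F → Measurable[G] Gm → Measurable[G] M →
        (∀ ω, 0 ≤ M ω) →
        (∀ᵐ ω ∂P, (vnorm (F ω)) ^ 2 ≤ L ^ 2 * Δ ^ (-(2 * lam)) * (1 + M ω)) →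
        (∀ᵐ ω ∂P, (frob (Gm ω)) ^ 2 ≤ L * Δ ^ (-lam) * (1 + M ω)) →
        Integrable (fun ω => (vnorm (x ω)) ^ (2 * p)) P →
        Integrable (fun ω => (M ω) ^ p) P →
        ∀ᵐ ω ∂P,
          (P[(fun ω' => (vnorm (x ω' + Δ • F ω' + mulv (Gm ω') (W ω'))) ^ (2 * p)) | G]) ω
            ≤ (vnorm (x ω)) ^ (2 * p)
              + (p : ℝ) * (vnorm (x ω)) ^ (2 * (p - 1))
                  * (2 * vdot (x ω) (F ω) + (2 * (p : ℝ) - 1) * (frob (Gm ω)) ^ 2) * Δ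
              + C * Δ * (1 + (vnorm (x ω)) ^ (2 * p) + (M ω) ^ p) := by
  obtain ⟨q, rfl⟩ : ∃ q, p = q + 1 := ⟨p - 1, by omega⟩
  obtain ⟨C, hC, H⟩ := exists_condExp_comap_step_le q n d hL
  refine ⟨C, hC, ?_⟩
  intro lam Δ hlam0 hlam hΔ hΔ1 Ω G mΩ P _ hG W hW hlaw hind x F A M hx hF hA hM hM0 hFb hAb
    hxi hMi
  have e1 : Δ ^ (-lam) * Δ = Δ ^ (1 - lam) := by
    rw [← Real.rpow_add_one hΔ.ne']
    ring_nf
  have e2 : Δ ^ (-(2 * lam)) * Δ ^ 2 = (Δ ^ (1 - lam)) ^ 2 := by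
    rw [← e1, mul_pow, ← Real.rpow_natCast (Δ ^ (-lam)), ← Real.rpow_mul hΔ.le]
    congr 2
    push_cast
    ring
  have hh : (Δ ^ (1 - lam)) ^ 2 ≤ Δ := by
    rw [← Real.rpow_natCast, ← Real.rpow_mul hΔ.le]
    conv_rhs => rw [← Real.rpow_one Δ]
    apply Real.rpow_le_rpow_of_exponent_ge hΔ hΔ1
    push_cast
    linarith
  have hind' : @ProbabilityTheory.IndepFun Ω Ω (Fin d → ℝ) mΩ G _ id W P := by
    refine (@ProbabilityTheory.IndepFun_iff Ω mΩ Ω (Fin d → ℝ) G _ id W P).mpr fun s t hs ht => ?_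
    rw [MeasurableSpace.comap_id] at hs
    rw [inter_comm, hind t s ht hs, mul_comm]
  have key := H Ω Ω mΩ G P (Δ ^ (1 - lam)) Δ (by positivity)
    (Real.rpow_le_one hΔ.le hΔ1 (by linarith)) hΔ hh id W (measurable_id'' hG) hW hlaw hind'
    x F A M hx hF hA hM hM0
    (by
      filter_upwards [hFb] with ω hω
      calc _ ≤ Δ ^ 2 * (L ^ 2 * Δ ^ (-(2 * lam)) * (1 + M ω)) :=
            mul_le_mul_of_nonneg_left hω (by positivity)
        _ = L ^ 2 * (Δ ^ (-(2 * lam)) * Δ ^ 2) * (1 + M ω) := by ring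
        _ = _ := by rw [e2, id_eq])
    (by
      filter_upwards [hAb] with ω hω
      calc _ ≤ L * Δ ^ (-lam) * (1 + M ω) * Δ := mul_le_mul_of_nonneg_right hω hΔ.le
        _ = L * (Δ ^ (-lam) * Δ) * (1 + M ω) := by ring
        _ = _ := by rw [e1, id_eq])
    (by simpa only [← pow_mul, id_eq] using hxi) hMi
  rw [MeasurableSpace.comap_id] at key
  filter_upwards [key] with ω hω
  simp only [← pow_mul, id_eq] at hω
  push_cast
  exact hω
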